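/- arXiv:2210.02905 — 6 statements merged into one kernel-verified Lean document; each statement's English description precedes it below -/
import Mathlib

section
/- Under the Gaussian box-decomposition setup, for every m, (1/W)·∫ (y m)·1_{f ∈ D} dP = μ m − (√(s m)/W)·Σ_{j=1}^J W[j]·G[j,m]/W[j,m]. (Here W > 0 holds automatically since J ≥ 1, l j m < u j m and s m > 0.) -/
open MeasureTheory ProbabilityTheory

noncomputable section

/-- The density of the standard normal distribution. -/
def stdPdf (z : ℝ) : ℝ := (Real.sqrt (2 * Real.pi))⁻¹ * Real.exp (-z ^ 2 / 2)

/-- The cumulative distribution function of the standard normal distribution. -/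
def stdCdf (x : ℝ) : ℝ := ∫ z in Set.Iic x, stdPdf z

/-- The standardization map `γ m c = (c − μ m)/√(s m)`. -/
def gam {M : ℕ} (μ s : Fin M → ℝ) (m : Fin M) (c : ℝ) : ℝ :=
  (c - μ m) / Real.sqrt (s m)

/-- `W[j,m] = Φ(γ m (u j m)) − Φ(γ m (l j m))`. -/
def Wjm {M J : ℕ} (μ s : Fin M → ℝ) (l u : Fin J → Fin M → ℝ) (j : Fin J) (m : Fin M) : ℝ :=
  stdCdf (gam μ s m (u j m)) - stdCdf (gam μ s m (l j m))

/-- `W[j] = ∏_m W[j,m]`. -/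
def Wj {M J : ℕ} (μ s : Fin M → ℝ) (l u : Fin J → Fin M → ℝ) (j : Fin J) : ℝ :=
  ∏ m, Wjm μ s l u j m

/-- `W = Σ_j W[j]`. -/
def Wtot {M J : ℕ} (μ s : Fin M → ℝ) (l u : Fin J → Fin M → ℝ) : ℝ :=
  ∑ j, Wj μ s l u j

/-- `G[j,m] = φ(γ m (u j m)) − φ(γ m (l j m))`. -/
def Gjm {M J : ℕ} (μ s : Fin M → ℝ) (l u : Fin J → Fin M → ℝ) (j : Fin J) (m : Fin M) : ℝ :=
  stdPdf (gam μ s m (u j m)) - stdPdf (gam μ s m (l j m))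

/-- `V[j,m] = γ m (u j m)·φ(γ m (u j m)) − γ m (l j m)·φ(γ m (l j m))`. -/
def Vjm {M J : ℕ} (μ s : Fin M → ℝ) (l u : Fin J → Fin M → ℝ) (j : Fin J) (m : Fin M) : ℝ :=
  gam μ s m (u j m) * stdPdf (gam μ s m (u j m))
    - gam μ s m (l j m) * stdPdf (gam μ s m (l j m))

/-- `ρ m = √(s m / (s m + σ m))`. -/
def rho {M : ℕ} (s σ : Fin M → ℝ) (m : Fin M) : ℝ := Real.sqrt (s m / (s m + σ m))

/-- The union `D = ⋃_j B j` of the boxes `B j`. -/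
def boxD {M J : ℕ} (l u : Fin J → Fin M → ℝ) : Set (Fin M → ℝ) :=
  ⋃ j, {z : Fin M → ℝ | ∀ m, l j m < z m ∧ z m ≤ u j m}

/-- The joint law of `(f, ε)`: the product of the two product Gaussian measures
`⨂_m N(μ m, s m)` and `⨂_m N(0, σ m)`. -/
def Pmeas {M : ℕ} (μ s σ : Fin M → ℝ) : Measure ((Fin M → ℝ) × (Fin M → ℝ)) :=
  (Measure.pi fun m => gaussianReal (μ m) (s m).toNNReal).prod
    (Measure.pi fun m => gaussianReal 0 (σ m).toNNReal)

end

lemma continuous_stdPdf : Continuous stdPdf := by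
  unfold stdPdf
  fun_prop

lemma stdPdf_pos (z : ℝ) : 0 < stdPdf z := by
  unfold stdPdf
  positivity

lemma stdPdf_eq_gaussianPDFReal : stdPdf = gaussianPDFReal 0 1 := by
  ext z
  simp [stdPdf, gaussianPDFReal]

lemma integrable_stdPdf : Integrable stdPdf :=
  stdPdf_eq_gaussianPDFReal ▸ integrable_gaussianPDFReal 0 1

lemma hasDerivAt_stdPdf (z : ℝ) : HasDerivAt stdPdf (-z * stdPdf z) z := by
  have h : HasDerivAt (fun z : ℝ => -z ^ 2 / 2) (-z) z :=
    (((hasDerivAt_id z).pow 2).neg.div_const 2).congr_deriv (by simp; ring)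
  exact (h.exp.const_mul (Real.sqrt (2 * Real.pi))⁻¹).congr_deriv (by rw [stdPdf]; ring)

lemma stdCdf_sub_stdCdf (a b : ℝ) : stdCdf b - stdCdf a = ∫ z in a..b, stdPdf z :=
  intervalIntegral.integral_Iic_sub_Iic integrable_stdPdf.integrableOn
    integrable_stdPdf.integrableOn

lemma integral_id_mul_stdPdf (a b : ℝ) :
    ∫ z in a..b, z * stdPdf z = -(stdPdf b - stdPdf a) := by
  rw [intervalIntegral.integral_eq_sub_of_hasDerivAt (f := fun z => -stdPdf z)]
  · ring
  · intro z _
    exact (hasDerivAt_stdPdf z).neg.congr_deriv (by ring)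
  · exact (continuous_id.mul continuous_stdPdf).intervalIntegrable _ _

lemma gaussianPDFReal_eq_stdPdf (μ x : ℝ) {v : ℝ} (hv : 0 < v) :
    gaussianPDFReal μ v.toNNReal x = (√v)⁻¹ * stdPdf ((x - μ) / √v) := by
  rw [gaussianPDFReal, stdPdf, Real.coe_toNNReal v hv.le, Real.sqrt_mul (by positivity), div_pow,
    Real.sq_sqrt hv.le, mul_inv, neg_div, neg_div, div_div, mul_comm v 2]
  ring

/-- Integrating over an interval against a Gaussian law amounts to integrating over the
standardized interval against the standard normal density. -/
lemma integral_mul_indicator_gaussianReal (μ : ℝ) {v a b : ℝ} (hv : 0 < v) (hab : a ≤ b)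
    (f : ℝ → ℝ) :
    ∫ x, f x * (Set.Ioc a b).indicator (fun _ => (1 : ℝ)) x ∂gaussianReal μ v.toNNReal
      = ∫ z in (a - μ) / √v..(b - μ) / √v, f (μ + √v * z) * stdPdf z := by
  have hsq : √v ≠ 0 := (Real.sqrt_pos.2 hv).ne'
  have hind (x : ℝ) : gaussianPDFReal μ v.toNNReal x •
      (f x * (Set.Ioc a b).indicator (fun _ => (1 : ℝ)) x)
      = (Set.Ioc a b).indicator
        (fun x => (√v)⁻¹ * (f (μ + √v * (x / √v - μ / √v)) * stdPdf (x / √v - μ / √v))) x := by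
    by_cases hx : x ∈ Set.Ioc a b
    · have hx' : μ + √v * (x / √v - μ / √v) = x := by field_simp; ring
      simp only [Set.indicator_of_mem hx, hx', gaussianPDFReal_eq_stdPdf μ x hv, sub_div,
        smul_eq_mul]
      ring
    · simp [Set.indicator_of_notMem hx]
  rw [integral_gaussianReal_eq_integral_smul (by simpa using hv)]
  simp_rw [hind]
  rw [integral_indicator measurableSet_Ioc, ← intervalIntegral.integral_of_le hab,
    intervalIntegral.integral_const_mul,
    intervalIntegral.integral_comp_div_sub (fun z => f (μ + √v * z) * stdPdf z) hsq, smul_eq_mul,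
    inv_mul_cancel_left₀ hsq, sub_div, sub_div]

lemma integral_indicator_gaussianReal (μ : ℝ) {v a b : ℝ} (hv : 0 < v) (hab : a ≤ b) :
    ∫ x, (Set.Ioc a b).indicator (fun _ => (1 : ℝ)) x ∂gaussianReal μ v.toNNReal
      = stdCdf ((b - μ) / √v) - stdCdf ((a - μ) / √v) := by
  simpa [stdCdf_sub_stdCdf] using integral_mul_indicator_gaussianReal μ hv hab fun _ => 1

lemma integral_id_mul_indicator_gaussianReal (μ : ℝ) {v a b : ℝ} (hv : 0 < v) (hab : a ≤ b) :
    ∫ x, x * (Set.Ioc a b).indicator (fun _ => (1 : ℝ)) x ∂gaussianReal μ v.toNNReal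
      = μ * (stdCdf ((b - μ) / √v) - stdCdf ((a - μ) / √v))
        - √v * (stdPdf ((b - μ) / √v) - stdPdf ((a - μ) / √v)) := by
  rw [integral_mul_indicator_gaussianReal μ hv hab fun x => x]
  simp_rw [add_mul, mul_assoc]
  rw [intervalIntegral.integral_add, intervalIntegral.integral_const_mul,
    intervalIntegral.integral_const_mul, stdCdf_sub_stdCdf, integral_id_mul_stdPdf]
  · ring
  · exact (continuous_stdPdf.const_mul μ).intervalIntegrable _ _
  · exact ((continuous_id.mul continuous_stdPdf).const_mul _).intervalIntegrable _ _

section Box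

variable {M J : ℕ} {μ s : Fin M → ℝ} {l u : Fin J → Fin M → ℝ}

lemma Wjm_pos (hs : ∀ m, 0 < s m) (hlu : ∀ j m, l j m < u j m) (j : Fin J) (m : Fin M) :
    0 < Wjm μ s l u j m := by
  rw [Wjm, stdCdf_sub_stdCdf]
  refine intervalIntegral.intervalIntegral_pos_of_pos
    (continuous_stdPdf.intervalIntegrable _ _) stdPdf_pos ?_
  have := Real.sqrt_pos.2 (hs m)
  have := hlu j m
  unfold gam
  gcongr

lemma Wtot_pos (hJ : 1 ≤ J) (hs : ∀ m, 0 < s m) (hlu : ∀ j m, l j m < u j m) :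
    0 < Wtot μ s l u :=
  Finset.sum_pos (fun j _ => Finset.prod_pos fun m _ => Wjm_pos hs hlu j m)
    ⟨⟨0, hJ⟩, Finset.mem_univ _⟩

lemma measurableSet_boxD : MeasurableSet (boxD l u) := by
  unfold boxD
  measurability

lemma indicator_box_eq_prod (a b z : Fin M → ℝ) :
    Set.indicator {z : Fin M → ℝ | ∀ m, a m < z m ∧ z m ≤ b m} (fun _ => (1 : ℝ)) z
      = ∏ m, (Set.Ioc (a m) (b m)).indicator (fun _ => (1 : ℝ)) (z m) := by
  classical
  simp [Set.indicator_apply, Finset.prod_ite_zero]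

lemma indicator_boxD_eq_sum (hdisj : Pairwise fun j j' : Fin J => Disjoint
      {z : Fin M → ℝ | ∀ m, l j m < z m ∧ z m ≤ u j m}
      {z : Fin M → ℝ | ∀ m, l j' m < z m ∧ z m ≤ u j' m}) (z : Fin M → ℝ) :
    Set.indicator (boxD l u) (fun _ => (1 : ℝ)) z
      = ∑ j, ∏ m, (Set.Ioc (l j m) (u j m)).indicator (fun _ => (1 : ℝ)) (z m) := by
  have h := Finset.indicator_biUnion_apply Finset.univ
    (fun j => {z : Fin M → ℝ | ∀ m, l j m < z m ∧ z m ≤ u j m}) (f := fun _ => (1 : ℝ))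
    (hdisj.set_pairwise _) z
  simpa [boxD, indicator_box_eq_prod] using h

/-- The truncated first moment of a product Gaussian law over a single box. -/
lemma integral_eval_mul_prod_indicator_pi (hs : ∀ m, 0 < s m) (hlu : ∀ j m, l j m < u j m)
    (j : Fin J) (m : Fin M) :
    ∫ z, z m * ∏ k, (Set.Ioc (l j k) (u j k)).indicator (fun _ => (1 : ℝ)) (z k)
        ∂(Measure.pi fun k => gaussianReal (μ k) (s k).toNNReal)
      = μ m * Wj μ s l u j - √(s m) * (Wj μ s l u j * (Gjm μ s l u j m / Wjm μ s l u j m)) := by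
  have hfac (z : Fin M → ℝ) :
      z m * ∏ k, (Set.Ioc (l j k) (u j k)).indicator (fun _ => (1 : ℝ)) (z k)
        = ∏ k, (if k = m then z k else 1)
          * (Set.Ioc (l j k) (u j k)).indicator (fun _ => (1 : ℝ)) (z k) := by
    rw [Finset.prod_mul_distrib, Finset.prod_ite_eq' Finset.univ m z, if_pos (Finset.mem_univ m)]
  simp_rw [hfac]
  rw [integral_fintype_prod_eq_prod (fun k x => (if k = m then x else 1)
      * (Set.Ioc (l j k) (u j k)).indicator (fun _ => (1 : ℝ)) x),
    ← Finset.mul_prod_erase _ _ (Finset.mem_univ m), Wj,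
    ← Finset.mul_prod_erase _ _ (Finset.mem_univ m)]
  have hrest : ∏ k ∈ Finset.univ.erase m, ∫ x, (if k = m then x else 1)
      * (Set.Ioc (l j k) (u j k)).indicator (fun _ => (1 : ℝ)) x
        ∂gaussianReal (μ k) (s k).toNNReal = ∏ k ∈ Finset.univ.erase m, Wjm μ s l u j k :=
    Finset.prod_congr rfl fun k hk => by
      simp only [if_neg (Finset.ne_of_mem_erase hk), one_mul]
      exact integral_indicator_gaussianReal (μ k) (hs k) (hlu j k).le
  have hm : ∫ x, x * (Set.Ioc (l j m) (u j m)).indicator (fun _ => (1 : ℝ)) x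
      ∂gaussianReal (μ m) (s m).toNNReal
      = μ m * Wjm μ s l u j m - √(s m) * Gjm μ s l u j m :=
    integral_id_mul_indicator_gaussianReal (μ m) (hs m) (hlu j m).le
  simp only [if_true]
  rw [hrest, hm]
  have := (Wjm_pos (μ := μ) hs hlu j m).ne'
  field_simp

lemma integrable_eval_pi_gaussianReal (μ v : Fin M → ℝ) (m : Fin M) :
    Integrable (fun z : Fin M → ℝ => z m)
      (Measure.pi fun k => gaussianReal (μ k) (v k).toNNReal) :=
  integrable_eval ((memLp_id_gaussianReal 1).integrable le_rfl)

lemma integral_eval_pi_gaussianReal (μ v : Fin M → ℝ) (m : Fin M) :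
    ∫ z, z m ∂(Measure.pi fun k => gaussianReal (μ k) (v k).toNNReal) = μ m := by
  rw [integral_eval]
  exact integral_id_gaussianReal

end Box

/-- First conditional moment:
`(1/W)·∫ (y m)·1_{f ∈ D} dP = μ m − (√(s m)/W)·Σ_j W[j]·G[j,m]/W[j,m]`. -/
theorem first_conditional_moment
    (M J : ℕ) (hM : 1 ≤ M) (hJ : 1 ≤ J)
    (μ s σ : Fin M → ℝ) (hs : ∀ m, 0 < s m) (hσ : ∀ m, 0 ≤ σ m)
    (l u : Fin J → Fin M → ℝ) (hlu : ∀ j m, l j m < u j m)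
    (hdisj : Pairwise fun j j' : Fin J => Disjoint
        {z : Fin M → ℝ | ∀ m, l j m < z m ∧ z m ≤ u j m}
        {z : Fin M → ℝ | ∀ m, l j' m < z m ∧ z m ≤ u j' m})
    (m : Fin M) :
    (1 / Wtot μ s l u) * ∫ p, (p.1 m + p.2 m)
        * Set.indicator (boxD l u) (fun _ => (1 : ℝ)) p.1 ∂(Pmeas μ s σ)
      = μ m - (Real.sqrt (s m) / Wtot μ s l u)
          * ∑ j, Wj μ s l u j * (Gjm μ s l u j m / Wjm μ s l u j m) := by
  set D : (Fin M → ℝ) → ℝ := Set.indicator (boxD l u) fun _ => 1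
  set P₁ := Measure.pi fun k => gaussianReal (μ k) (s k).toNNReal with hP₁
  set P₂ := Measure.pi fun k => gaussianReal 0 (σ k).toNNReal
  have hD : Integrable D P₁ := (integrable_const 1).indicator measurableSet_boxD
  have hbox (S : Set (Fin M → ℝ)) (hS : MeasurableSet S) :
      Integrable (fun z => z m * S.indicator (fun _ => (1 : ℝ)) z) P₁ := by
    refine ((integrable_eval_pi_gaussianReal μ s m).indicator hS).congr (.of_forall fun z => ?_)
    by_cases hz : z ∈ S <;> simp [hz]
  have hxD : Integrable (fun z => z m * D z) P₁ := hbox _ measurableSet_boxD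
  have hε : Integrable (fun e : Fin M → ℝ => e m) P₂ := integrable_eval_pi_gaussianReal 0 σ m
  have hε0 : ∫ e, e m ∂P₂ = 0 := integral_eval_pi_gaussianReal 0 σ m
  have hsplit : ∫ p, (p.1 m + p.2 m) * D p.1 ∂(Pmeas μ s σ) = ∫ z, z m * D z ∂P₁ := by
    have hrw (p : (Fin M → ℝ) × (Fin M → ℝ)) :
        (p.1 m + p.2 m) * D p.1 = p.1 m * D p.1 + D p.1 * p.2 m := by ring
    simp_rw [hrw]
    change ∫ p, _ ∂(P₁.prod P₂) = _
    rw [integral_add (hxD.comp_fst P₂) (hD.mul_prod hε), integral_fun_fst (fun z => z m * D z),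
      integral_prod_mul D fun e : Fin M → ℝ => e m, hε0]
    simp
  have hmoment : ∫ z, z m * D z ∂P₁ = μ m * Wtot μ s l u
      - √(s m) * ∑ j, Wj μ s l u j * (Gjm μ s l u j m / Wjm μ s l u j m) := by
    simp_rw [D, indicator_boxD_eq_sum hdisj, Finset.mul_sum]
    rw [integral_finsetSum]
    · simp_rw [hP₁, integral_eval_mul_prod_indicator_pi hs hlu, Finset.sum_sub_distrib, Wtot,
        Finset.mul_sum]
    · intro j _
      simp_rw [← indicator_box_eq_prod]
      exact hbox _ (by measurability)
  have hW := (Wtot_pos (μ := μ) hJ hs hlu).ne'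
  rw [hsplit, hmoment]
  field_simp
end

section
/- Under the Gaussian box-decomposition setup, for every t : Fin M → ℝ, the restricted moment generating function satisfies ∫ exp(Σ_m t m · ȳ m)·1_{f ∈ D} dP = Σ_{j=1}^J ∏_{m=1}^M exp((t m)²/2) · ( Φ(γ m (u j m) − ρ m · t m) − Φ(γ m (l j m) − ρ m · t m) ). -/
open MeasureTheory ProbabilityTheory

/-- Completing the square: exponential tilting shifts the Gaussian density. -/
lemma gaussianPDFReal_mul_exp (μ a x : ℝ) {s : ℝ} (hs : 0 < s) :
    gaussianPDFReal μ s.toNNReal x * Real.exp (a * (x - μ))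
      = Real.exp (a ^ 2 * s / 2)
        * ((Real.sqrt s)⁻¹ * stdPdf ((Real.sqrt s)⁻¹ * x - (μ / Real.sqrt s + a * Real.sqrt s))) := by
  obtain ⟨r, hr, rfl⟩ : ∃ r : ℝ, 0 < r ∧ s = r ^ 2 :=
    ⟨Real.sqrt s, Real.sqrt_pos.2 hs, (Real.sq_sqrt hs.le).symm⟩
  have hexp : Real.exp (-(x - μ) ^ 2 / (2 * r ^ 2)) * Real.exp (a * (x - μ))
      = Real.exp (a ^ 2 * r ^ 2 / 2) * Real.exp (-(r⁻¹ * x - (μ / r + a * r)) ^ 2 / 2) := by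
    rw [← Real.exp_add, ← Real.exp_add]
    congr 1
    field_simp
    ring
  rw [gaussianPDFReal, stdPdf, Real.coe_toNNReal _ hs.le, Real.sqrt_sq hr.le,
    Real.sqrt_mul (by positivity), Real.sqrt_sq hr.le, mul_inv]
  linear_combination (Real.sqrt (2 * Real.pi))⁻¹ * r⁻¹ * hexp

/-- The moment generating function of a centred Gaussian variable restricted to an interval. -/
lemma setIntegral_Ioc_exp_gaussianReal (μ a : ℝ) {s l u : ℝ} (hs : 0 < s) (hlu : l ≤ u) :
    ∫ x in Set.Ioc l u, Real.exp (a * (x - μ)) ∂(gaussianReal μ s.toNNReal)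
      = Real.exp (a ^ 2 * s / 2)
        * (stdCdf ((u - μ) / Real.sqrt s - a * Real.sqrt s)
          - stdCdf ((l - μ) / Real.sqrt s - a * Real.sqrt s)) := by
  rw [← integral_indicator measurableSet_Ioc,
    integral_gaussianReal_eq_integral_smul (Real.toNNReal_pos.2 hs).ne']
  simp_rw [← Set.indicator_smul_apply (Set.Ioc l u) (gaussianPDFReal μ s.toNNReal), smul_eq_mul]
  rw [integral_indicator measurableSet_Ioc, ← intervalIntegral.integral_of_le hlu]
  simp_rw [gaussianPDFReal_mul_exp μ a _ hs]
  rw [intervalIntegral.integral_const_mul, intervalIntegral.integral_const_mul,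
    intervalIntegral.mul_integral_comp_mul_sub, stdCdf_sub_stdCdf]
  congr 2 <;> ring

lemma integrable_exp_mul_sub_gaussianReal (μ a : ℝ) (v : NNReal) :
    Integrable (fun x => Real.exp (a * (x - μ))) (gaussianReal μ v) := by
  simp_rw [mul_sub, Real.exp_sub]
  exact (integrable_exp_mul_gaussianReal a).div_const _

lemma integral_exp_mul_gaussianReal_zero (a : ℝ) (v : NNReal) :
    ∫ x, Real.exp (a * x) ∂(gaussianReal 0 v) = Real.exp (a ^ 2 * v / 2) := by
  have h := congrFun (mgf_fun_id_gaussianReal (μ := 0) (v := v)) a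
  rw [mgf] at h
  rw [h]
  congr 1
  ring

lemma indicator_boxD {M J : ℕ} {l u : Fin J → Fin M → ℝ}
    (hdisj : Pairwise fun j j' : Fin J => Disjoint
        {z : Fin M → ℝ | ∀ m, l j m < z m ∧ z m ≤ u j m}
        {z : Fin M → ℝ | ∀ m, l j' m < z m ∧ z m ≤ u j' m}) (z : Fin M → ℝ) :
    Set.indicator (boxD l u) (fun _ => (1 : ℝ)) z
      = ∑ j, ∏ m, Set.indicator (Set.Ioc (l j m) (u j m)) (fun _ => (1 : ℝ)) (z m) := by
  classical
  have hbox (j : Fin J) :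
      ∏ m, Set.indicator (Set.Ioc (l j m) (u j m)) (fun _ => (1 : ℝ)) (z m)
        = if ∀ m, l j m < z m ∧ z m ≤ u j m then 1 else 0 := by
    simp only [Set.indicator_apply, Set.mem_Ioc, Finset.prod_ite_zero, Finset.mem_univ,
      forall_true_left, Finset.prod_const_one]
  simp_rw [hbox]
  by_cases hz : z ∈ boxD l u
  · obtain ⟨j, hj⟩ := Set.mem_iUnion.1 hz
    rw [Set.indicator_of_mem hz, Finset.sum_eq_single j]
    · exact (if_pos hj).symm
    · exact fun j' _ hne => if_neg fun hj' => Set.disjoint_left.1 (hdisj hne) hj' hj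
    · simp
  · rw [Set.indicator_of_notMem hz, Finset.sum_eq_zero]
    exact fun j _ => if_neg fun hj => hz (Set.mem_iUnion.2 ⟨j, hj⟩)

/-- Restricted moment generating function of the standardized observations. -/
theorem restricted_mgf
    (M J : ℕ) (hM : 1 ≤ M) (hJ : 1 ≤ J)
    (μ s σ : Fin M → ℝ) (hs : ∀ m, 0 < s m) (hσ : ∀ m, 0 ≤ σ m)
    (l u : Fin J → Fin M → ℝ) (hlu : ∀ j m, l j m < u j m)
    (hdisj : Pairwise fun j j' : Fin J => Disjoint
        {z : Fin M → ℝ | ∀ m, l j m < z m ∧ z m ≤ u j m}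
        {z : Fin M → ℝ | ∀ m, l j' m < z m ∧ z m ≤ u j' m})
    (t : Fin M → ℝ) :
    ∫ p, Real.exp (∑ m, t m * ((p.1 m + p.2 m - μ m) / Real.sqrt (s m + σ m)))
        * Set.indicator (boxD l u) (fun _ => (1 : ℝ)) p.1 ∂(Pmeas μ s σ)
      = ∑ j, ∏ m, Real.exp (t m ^ 2 / 2)
          * (stdCdf (gam μ s m (u j m) - rho s σ m * t m)
              - stdCdf (gam μ s m (l j m) - rho s σ m * t m)) := by
  set a : Fin M → ℝ := fun m => t m / Real.sqrt (s m + σ m) with ha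
  have hfactor (p : (Fin M → ℝ) × (Fin M → ℝ)) :
      Real.exp (∑ m, t m * ((p.1 m + p.2 m - μ m) / Real.sqrt (s m + σ m)))
          * Set.indicator (boxD l u) (fun _ => (1 : ℝ)) p.1
        = (∑ j, ∏ m, Set.indicator (Set.Ioc (l j m) (u j m))
              (fun x => Real.exp (a m * (x - μ m))) (p.1 m))
            * ∏ m, Real.exp (a m * p.2 m) := by
    have hexp : Real.exp (∑ m, t m * ((p.1 m + p.2 m - μ m) / Real.sqrt (s m + σ m)))
        = (∏ m, Real.exp (a m * (p.1 m - μ m))) * ∏ m, Real.exp (a m * p.2 m) := by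
      rw [← Finset.prod_mul_distrib, Real.exp_sum]
      refine Finset.prod_congr rfl fun m _ => ?_
      rw [← Real.exp_add]
      congr 1
      simp only [ha]
      ring
    rw [hexp, indicator_boxD hdisj, mul_right_comm, Finset.mul_sum]
    congr 1
    refine Finset.sum_congr rfl fun j _ => ?_
    rw [← Finset.prod_mul_distrib]
    refine Finset.prod_congr rfl fun m _ => ?_
    by_cases h : p.1 m ∈ Set.Ioc (l j m) (u j m) <;> simp [h]
  simp_rw [hfactor, Pmeas]
  rw [integral_prod_mul (fun f : Fin M → ℝ => ∑ j, ∏ m, Set.indicator (Set.Ioc (l j m) (u j m))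
      (fun x => Real.exp (a m * (x - μ m))) (f m))
      (fun ε : Fin M → ℝ => ∏ m, Real.exp (a m * ε m)),
    integral_finsetSum _ fun j _ => Integrable.fintype_prod fun m =>
      (integrable_exp_mul_sub_gaussianReal (μ m) (a m) _).indicator measurableSet_Ioc,
    integral_fintype_prod_eq_prod (f := fun m x => Real.exp (a m * x)), Finset.sum_mul]
  refine Finset.sum_congr rfl fun j _ => ?_
  rw [integral_fintype_prod_eq_prod (f := fun m => Set.indicator (Set.Ioc (l j m) (u j m))
      (fun x => Real.exp (a m * (x - μ m)))), ← Finset.prod_mul_distrib]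
  refine Finset.prod_congr rfl fun m _ => ?_
  have hpos : 0 < s m + σ m := add_pos_of_pos_of_nonneg (hs m) (hσ m)
  have hvar : a m ^ 2 * s m / 2 + a m ^ 2 * σ m / 2 = t m ^ 2 / 2 := by
    simp only [ha, div_pow, Real.sq_sqrt hpos.le]
    field_simp
  have hrho : a m * Real.sqrt (s m) = rho s σ m * t m := by
    rw [rho, Real.sqrt_div (hs m).le]
    simp only [ha]
    ring
  rw [integral_indicator measurableSet_Ioc,
    setIntegral_Ioc_exp_gaussianReal (μ m) (a m) (hs m) (hlu j m).le,
    integral_exp_mul_gaussianReal_zero, Real.coe_toNNReal _ (hσ m), mul_right_comm,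
    ← Real.exp_add, hvar, hrho]
  rfl
end

section
/- For all real numbers a and b, ∫_ℝ Φ(a·z + b) · φ(z) dz = Φ(b/√(1 + a²)), where the integral is with respect to Lebesgue measure on ℝ. -/
open MeasureTheory

open ProbabilityTheory in
lemma gaussianPDFReal_zero_one : gaussianPDFReal 0 1 = stdPdf := by
  ext x
  simp [gaussianPDFReal, stdPdf]

open ProbabilityTheory in
lemma stdCdf_eq_gaussianReal_real_Iic (x : ℝ) :
    stdCdf x = (gaussianReal 0 1).real (Set.Iic x) := by
  rw [measureReal_def, gaussianReal_apply_eq_integral 0 one_ne_zero, gaussianPDFReal_zero_one,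
    ENNReal.toReal_ofReal, stdCdf]
  exact integral_nonneg fun z => by unfold stdPdf; positivity

open ProbabilityTheory in
lemma integral_mul_stdPdf (f : ℝ → ℝ) :
    ∫ z, f z * stdPdf z = ∫ z, f z ∂gaussianReal 0 1 := by
  rw [integral_gaussianReal_eq_integral_smul one_ne_zero, gaussianPDFReal_zero_one]
  simp only [smul_eq_mul, mul_comm]

/-- The left-hand side is `P (X ≤ a * Z + b)` for independent `X` and `Z`. -/
lemma lintegral_measure_Iic_affine (μ ν : Measure ℝ) [SFinite μ] [SFinite ν] (a b : ℝ) :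
    ∫⁻ z, ν (Set.Iic (a * z + b)) ∂μ = ((μ.map (-a * ·)) ∗ ν) (Set.Iic b) := by
  have hs : MeasurableSet ((fun p : ℝ × ℝ => p.1 + p.2) ⁻¹' Set.Iic b) :=
    measurableSet_Iic.preimage (by fun_prop)
  rw [Measure.conv, Measure.map_apply (by fun_prop) measurableSet_Iic, Measure.prod_apply hs,
    lintegral_map (measurable_measure_prodMk_left hs) (by fun_prop)]
  refine lintegral_congr fun z => congrArg ν ?_
  ext x
  simp only [Set.mem_Iic, Set.mem_preimage]
  constructor <;> intro h <;> linarith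

open ProbabilityTheory in
lemma gaussianReal_real_Iic_sq (c b : ℝ) (hc : 0 < c) :
    (gaussianReal 0 (.mk (c ^ 2) (sq_nonneg c))).real (Set.Iic b) = stdCdf (b / c) := by
  have h := gaussianReal_map_const_mul (μ := 0) (v := 1) c
  rw [mul_zero, mul_one] at h
  rw [← h, map_measureReal_apply (by fun_prop) measurableSet_Iic,
    stdCdf_eq_gaussianReal_real_Iic]
  congr 1
  ext x
  simp [le_div_iff₀' hc]

/-- (Lemma 2 of Azzalini 1985.) For all reals `a` and `b`,
`∫ Φ(a·z + b) · φ(z) dz = Φ(b/√(1 + a²))`. -/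
theorem integral_stdCdf_affine_mul_stdPdf (a b : ℝ) :
    ∫ z : ℝ, stdCdf (a * z + b) * stdPdf z
      = stdCdf (b / Real.sqrt (1 + a ^ 2)) := by
  rw [integral_mul_stdPdf]
  simp only [stdCdf_eq_gaussianReal_real_Iic (a * _ + b), measureReal_def]
  have hmono : Monotone fun x : ℝ => ProbabilityTheory.gaussianReal 0 1 (Set.Iic x) :=
    fun _ _ h => measure_mono (Set.Iic_subset_Iic.2 h)
  have hmeas : Measurable fun z : ℝ => ProbabilityTheory.gaussianReal 0 1 (Set.Iic (a * z + b)) :=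
    hmono.measurable.comp (by fun_prop)
  rw [integral_toReal hmeas.aemeasurable (.of_forall fun z => measure_lt_top _ _),
    lintegral_measure_Iic_affine, ProbabilityTheory.gaussianReal_map_const_mul,
    ProbabilityTheory.gaussianReal_conv_gaussianReal,
    ← gaussianReal_real_Iic_sq _ b (by positivity), measureReal_def]
  congr 3
  · simp
  · ext
    simp [add_comm (1 : ℝ), Real.sq_sqrt (by positivity : 0 ≤ a ^ 2 + 1)]
end

section
/- Let V be a finite type with decidable equality, let M ≥ 1, let A : Fin M → Matrix V V ℝ be a family of positive definite matrices, and let ζ : V → ℝ. For each m define the matrix K m by (K m) i j = exp(ζ i / M) · exp(ζ j / M) · (A m) i j, and define the set function g : Finset V → ℝ by g S = (1/2) · Σ_{m} Real.log (det ((K m).submatrix (Subtype.val : {x // x ∈ S} → V) Subtype.val)), where the determinant of the empty matrix is 1. Then g is submodular: for all S, T : Finset V, g (S ∩ T) + g (S ∪ T) ≤ g S + g T. -/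
open Matrix in
/-- The determinant of a principal submatrix factors through the Schur complement. -/
theorem Matrix.det_submatrix_sumElim {V R α β : Type*} [CommRing R]
    [Fintype α] [DecidableEq α] [Fintype β] [DecidableEq β]
    (K : Matrix V V R) (p : α → V) (w : β → V) (h : IsUnit (K.submatrix p p).det) :
    (K.submatrix (Sum.elim p w) (Sum.elim p w)).det =
      (K.submatrix p p).det *
        ((K - K.submatrix id p * (K.submatrix p p)⁻¹ * K.submatrix p id).submatrix w w).det := by
  let _ := invertibleOfIsUnitDet _ h
  have hblocks : K.submatrix (Sum.elim p w) (Sum.elim p w) =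
      fromBlocks (K.submatrix p p) (K.submatrix p w) (K.submatrix w p) (K.submatrix w w) := by
    ext (i | i) (j | j) <;> rfl
  rw [hblocks, det_fromBlocks₁₁, invOf_eq_nonsing_inv]
  rfl

open Matrix in
/-- For a symmetric real matrix, bordering an invertible principal submatrix by two indices gives
at most the product of the bordered minors for each index, up to the minor itself. -/
theorem Matrix.IsHermitian.det_submatrix_sumElim_pair_mul_le {V α : Type*}
    [Fintype α] [DecidableEq α] {K : Matrix V V ℝ} (hK : K.IsHermitian) (p : α → V) (u v : V)
    (h : IsUnit (K.submatrix p p).det) :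
    (K.submatrix (Sum.elim p ![u, v]) (Sum.elim p ![u, v])).det * (K.submatrix p p).det ≤
      (K.submatrix (Sum.elim p ![u]) (Sum.elim p ![u])).det *
        (K.submatrix (Sum.elim p ![v]) (Sum.elim p ![v])).det := by
  simp only [det_submatrix_sumElim _ _ _ h]
  generalize hX : K - K.submatrix id p * (K.submatrix p p)⁻¹ * K.submatrix p id = X
  have hsymm : X v u = X u v := by
    have hKt : Kᵀ = K := by simpa [IsHermitian] using hK
    have hXt : Xᵀ = X := by
      rw [← hX]
      simp only [transpose_sub, transpose_mul, transpose_nonsing_inv, transpose_submatrix, hKt,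
        Matrix.mul_assoc]
    exact congrFun (congrFun hXt u) v
  simp only [det_fin_two, det_fin_one, submatrix_apply, cons_val_zero, cons_val_one, hsymm]
  nlinarith [mul_nonneg (sq_nonneg (K.submatrix p p).det) (sq_nonneg (X u v))]

/-- A principal minor may be computed through any injective enumeration of its index set. -/
theorem Matrix.det_submatrix_val_eq {V R α : Type*} [DecidableEq V] [CommRing R]
    [Fintype α] [DecidableEq α] (K : Matrix V V R) (S : Finset V) (p : α → V)
    (hp : Function.Injective p) (hS : ∀ x, x ∈ S ↔ x ∈ Set.range p) :
    (K.submatrix (Subtype.val : {x // x ∈ S} → V) Subtype.val).det = (K.submatrix p p).det := by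
  let e : α ≃ {x // x ∈ S} := Equiv.ofBijective (fun a => ⟨p a, (hS _).2 ⟨a, rfl⟩⟩)
    ⟨fun a b h => hp (congrArg Subtype.val h), fun ⟨x, hx⟩ => by
      obtain ⟨a, rfl⟩ := (hS x).1 hx
      exact ⟨a, rfl⟩⟩
  rw [← det_submatrix_equiv_self e]
  rfl

theorem Matrix.PosDef.det_submatrix_val_pos {V : Type*} [DecidableEq V]
    {K : Matrix V V ℝ} (hK : K.PosDef) (S : Finset V) :
    0 < (K.submatrix (Subtype.val : {x // x ∈ S} → V) Subtype.val).det :=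
  (hK.submatrix Subtype.val_injective).det_pos

open Matrix in
/-- Principal minors of a positive definite matrix are log-submodular, in local exchange form. -/
theorem Matrix.PosDef.det_submatrix_insert_insert_mul_le {V : Type*} [DecidableEq V]
    {K : Matrix V V ℝ} (hK : K.PosDef) {S : Finset V} {u v : V}
    (hu : u ∉ S) (hv : v ∉ S) (huv : u ≠ v) :
    (K.submatrix (Subtype.val : {x // x ∈ insert u (insert v S)} → V) Subtype.val).det *
        (K.submatrix (Subtype.val : {x // x ∈ S} → V) Subtype.val).det ≤
      (K.submatrix (Subtype.val : {x // x ∈ insert u S} → V) Subtype.val).det *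
        (K.submatrix (Subtype.val : {x // x ∈ insert v S} → V) Subtype.val).det := by
  have hsingle (a : V) (ha : a ∉ S) :=
    det_submatrix_val_eq K (insert a S) (Sum.elim (Subtype.val : {x // x ∈ S} → V) ![a])
      (Subtype.val_injective.sumElim (Function.injective_of_subsingleton _)
        (by rintro ⟨x, hx⟩ i rfl; fin_cases i; exact ha hx))
      (by intro x; simp [eq_comm])
  have hpair := det_submatrix_val_eq K (insert u (insert v S))
    (Sum.elim (Subtype.val : {x // x ∈ S} → V) ![u, v])
    (Subtype.val_injective.sumElim (by
        intro i j h
        fin_cases i <;> fin_cases j <;> simp_all)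
      (by
        rintro ⟨x, hx⟩ i rfl
        fin_cases i
        exacts [hu hx, hv hx]))
    (by intro x; simp [eq_comm, or_left_comm])
  rw [hsingle u hu, hsingle v hv, hpair]
  exact hK.isHermitian.det_submatrix_sumElim_pair_mul_le _ u v
    (hK.submatrix Subtype.val_injective).det_pos.ne'.isUnit

/-- A set function satisfying the local exchange inequality is submodular. -/
theorem Finset.submodular_of_insert_insert {V : Type*} [DecidableEq V] (f : Finset V → ℝ)
    (h : ∀ S u v, u ∉ S → v ∉ S → u ≠ v →
      f (insert u (insert v S)) + f S ≤ f (insert u S) + f (insert v S))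
    (S T : Finset V) : f (S ∩ T) + f (S ∪ T) ≤ f S + f T := by
  have hinsert : ∀ (S D : Finset V) (u : V), Disjoint D S → u ∉ D → u ∉ S →
      f (insert u (D ∪ S)) + f S ≤ f (insert u S) + f (D ∪ S) := by
    intro S D u hD huD huS
    induction D using Finset.induction_on with
    | empty => simp [add_comm]
    | insert v D hv ih =>
      simp only [Finset.disjoint_insert_left, Finset.mem_insert, not_or] at hD huD
      have := ih hD.2 huD.2
      have := h (D ∪ S) u v (by simp [huD, huS]) (by simp [hv, hD]) huD.1
      rw [Finset.insert_union]
      linarith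
  have hunion : ∀ S D E : Finset V, Disjoint D S → Disjoint E (D ∪ S) →
      f (E ∪ (D ∪ S)) + f S ≤ f (E ∪ S) + f (D ∪ S) := by
    intro S D E hD hE
    induction E using Finset.induction_on with
    | empty => simp [add_comm]
    | insert u E hu ih =>
      simp only [Finset.disjoint_insert_left, Finset.mem_union, not_or] at hE
      have := ih hE.2
      have := hinsert (E ∪ S) D u
        (Finset.disjoint_union_right.2
          ⟨(Finset.disjoint_union_right.1 hE.2).1.symm, hD⟩) hE.1.1 (by simp [hu, hE])
      rw [Finset.union_left_comm] at this
      rw [Finset.insert_union, Finset.insert_union]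
      linarith
  have hT : T \ S ∪ S ∩ T = T := by grind
  have hS : S \ T ∪ S ∩ T = S := by grind
  have hST : S \ T ∪ T = S ∪ T := by grind
  have := hunion (S ∩ T) (T \ S) (S \ T)
    (by rw [Finset.disjoint_left]; grind) (by rw [Finset.disjoint_left]; grind)
  rw [hT, hS, hST] at this
  linarith


/-- The DPP-style batch acquisition function arising in the submodularity proof
(Appendix F): with `(K m) i j = exp(ζ i / M) · exp(ζ j / M) · (A m) i j` for positive
definite matrices `A m`, the set function
`g S = (1/2) · Σ_m log det ((K m) restricted to S)` is submodular. -/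
theorem batch_logdet_submodular {V : Type*} [Fintype V] [DecidableEq V]
    (M : ℕ) (hM : 1 ≤ M)
    (A : Fin M → Matrix V V ℝ) (hA : ∀ m, (A m).PosDef)
    (ζ : V → ℝ)
    (K : Fin M → Matrix V V ℝ)
    (hK : ∀ m i j, K m i j = Real.exp (ζ i / M) * Real.exp (ζ j / M) * A m i j)
    (g : Finset V → ℝ)
    (hg : ∀ S : Finset V,
      g S = (1 / 2 : ℝ) * ∑ m, Real.log
        (Matrix.det ((K m).submatrix (Subtype.val : {x // x ∈ S} → V) Subtype.val))) :
    ∀ S T : Finset V, g (S ∩ T) + g (S ∪ T) ≤ g S + g T := by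
  have hKpos : ∀ m, (K m).PosDef := by
    intro m
    let D : Matrix V V ℝ := Matrix.diagonal fun i => Real.exp (ζ i / M)
    have hKm : K m = D.conjTranspose * A m * D := by
      ext i j
      simp only [D, hK, Matrix.diagonal_conjTranspose, Matrix.mul_diagonal,
        Matrix.diagonal_mul, star_trivial]
      ring
    rw [hKm]
    refine (hA m).conjTranspose_mul_mul_same (Matrix.mulVec_injective_of_isUnit ?_)
    rw [Matrix.isUnit_iff_isUnit_det, Matrix.det_diagonal]
    exact (Finset.prod_pos fun i _ => Real.exp_pos _).ne'.isUnit
  refine Finset.submodular_of_insert_insert g fun S u v hu hv huv => ?_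
  simp only [hg, ← mul_add, ← Finset.sum_add_distrib]
  refine mul_le_mul_of_nonneg_left (Finset.sum_le_sum fun m _ => ?_) (by norm_num)
  have hpos := (hKpos m).det_submatrix_val_pos
  rw [← Real.log_mul (hpos _).ne' (hpos _).ne', ← Real.log_mul (hpos _).ne' (hpos _).ne']
  exact Real.log_le_log (mul_pos (hpos _) (hpos _))
    ((hKpos m).det_submatrix_insert_insert_mul_le hu hv huv)
end

section
/- Let V be a finite type with decidable equality and let K : Matrix V V ℝ be positive definite. Then the log-determinant set function f : Finset V → ℝ defined by f S = Real.log (det (K.submatrix (Subtype.val : {x // x ∈ S} → V) Subtype.val)) (with f ∅ = 0, since the determinant of the empty matrix is 1) is submodular: for all S, T : Finset V, f (S ∩ T) + f (S ∪ T) ≤ f S + f T. -/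
namespace Matrix

/-- Adding the identity to a positive semidefinite matrix gives determinant at least one. -/
theorem PosSemidef.one_le_det_one_add {n : Type*} [Fintype n] [DecidableEq n]
    {A : Matrix n n ℝ} (hA : A.PosSemidef) : 1 ≤ (1 + A).det := by
  have hH : (1 + A).IsHermitian := isHermitian_one.add hA.isHermitian
  rw [hH.det_eq_prod_eigenvalues]
  refine Finset.one_le_prod fun i _ => ?_
  have hnorm : star (hH.eigenvectorBasis i).ofLp ⬝ᵥ (hH.eigenvectorBasis i).ofLp = 1 := by
    have h := hH.eigenvectorBasis.orthonormal.1 i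
    rw [EuclideanSpace.norm_eq, Real.sqrt_eq_one] at h
    simpa [dotProduct, sq] using h
  have hnonneg := hA.dotProduct_mulVec_nonneg (hH.eigenvectorBasis i).ofLp
  have heig := hH.eigenvalues_eq i
  rw [add_mulVec, one_mulVec, dotProduct_add, hnorm] at heig
  simp only [RCLike.re_to_real] at heig
  simpa [heig] using hnonneg

open scoped MatrixOrder Matrix.Norms.L2Operator in
/-- The determinant is monotone under adding a positive semidefinite matrix `Bᴴ * A * B`. -/
theorem PosDef.det_le_det_add_conjTranspose_mul_mul {m n : Type*} [Fintype m] [DecidableEq m]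
    [Fintype n] [DecidableEq n] {N : Matrix n n ℝ} {A : Matrix m m ℝ} (hN : N.PosDef)
    (hA : A.PosSemidef) (B : Matrix m n ℝ) : N.det ≤ (N + Bᴴ * A * B).det := by
  obtain ⟨C, rfl⟩ := CStarAlgebra.nonneg_iff_eq_star_mul_self.mp hA.nonneg
  have hfactor : Bᴴ * (star C * C) * B = (C * B)ᴴ * (C * B) := by
    simp [star_eq_conjTranspose, Matrix.mul_assoc]
  rw [hfactor, det_add_mul _ _ hN.det_pos.ne'.isUnit]
  exact le_mul_of_one_le_right hN.det_pos.le
    (hN.inv.posSemidef.mul_mul_conjTranspose_same (C * B)).one_le_det_one_add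

/-- The Schur complement of the top left block. -/
noncomputable def schurComplement {m n : Type*} [Fintype m] [DecidableEq m]
    (M : Matrix (m ⊕ n) (m ⊕ n) ℝ) : Matrix n n ℝ :=
  M.toBlocks₂₂ - M.toBlocks₂₁ * M.toBlocks₁₁⁻¹ * M.toBlocks₁₂

section SchurComplement

variable {l m n : Type*}

theorem IsHermitian.toBlocks₂₁ {M : Matrix (m ⊕ n) (m ⊕ n) ℝ} (hM : M.IsHermitian) :
    M.toBlocks₂₁ = M.toBlocks₁₂ᴴ := by
  ext i j
  exact (hM.apply _ _).symm

theorem PosDef.toBlocks₁₁ {M : Matrix (m ⊕ n) (m ⊕ n) ℝ} (hM : M.PosDef) :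
    M.toBlocks₁₁.PosDef :=
  hM.submatrix Sum.inl_injective

variable [Fintype l] [DecidableEq l] [Fintype m] [DecidableEq m] [Fintype n] [DecidableEq n]

theorem PosDef.det_eq_mul_det_schurComplement {M : Matrix (m ⊕ n) (m ⊕ n) ℝ} (hM : M.PosDef) :
    M.det = M.toBlocks₁₁.det * M.schurComplement.det := by
  have : Invertible M.toBlocks₁₁ := hM.toBlocks₁₁.isUnit.invertible
  conv_lhs => rw [← fromBlocks_toBlocks M]
  rw [det_fromBlocks₁₁, invOf_eq_nonsing_inv, schurComplement]

theorem PosDef.schurComplement {M : Matrix (m ⊕ n) (m ⊕ n) ℝ} (hM : M.PosDef) :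
    M.schurComplement.PosDef := by
  have : Invertible M.toBlocks₁₁ := hM.toBlocks₁₁.isUnit.invertible
  have hpsd : M.schurComplement.PosSemidef := by
    rw [Matrix.schurComplement, hM.isHermitian.toBlocks₂₁,
      ← PosDef.fromBlocks₁₁ _ _ hM.toBlocks₁₁, ← hM.isHermitian.toBlocks₂₁, fromBlocks_toBlocks]
    exact hM.posSemidef
  refine hpsd.posDef_iff_det_ne_zero.mpr fun h => hM.det_pos.ne' ?_
  rw [hM.det_eq_mul_det_schurComplement, h, mul_zero]

/-- **Fischer's inequality**. -/
theorem PosDef.det_le_det_toBlocks₁₁_mul_det_toBlocks₂₂ {M : Matrix (m ⊕ n) (m ⊕ n) ℝ}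
    (hM : M.PosDef) : M.det ≤ M.toBlocks₁₁.det * M.toBlocks₂₂.det := by
  rw [hM.det_eq_mul_det_schurComplement]
  refine mul_le_mul_of_nonneg_left ?_ hM.toBlocks₁₁.det_pos.le
  have h := hM.schurComplement.det_le_det_add_conjTranspose_mul_mul
    hM.toBlocks₁₁.inv.posSemidef M.toBlocks₁₂
  rwa [← hM.isHermitian.toBlocks₂₁, Matrix.schurComplement, sub_add_cancel] at h

theorem PosDef.det_submatrix_sumMap {k : Type*} {M : Matrix (l ⊕ k) (l ⊕ k) ℝ} (hM : M.PosDef)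
    {e : m → k} (he : Function.Injective e) :
    (M.submatrix (Sum.map id e) (Sum.map id e)).det =
      M.toBlocks₁₁.det * (M.schurComplement.submatrix e e).det :=
  (hM.submatrix (Function.injective_id.sumMap he)).det_eq_mul_det_schurComplement

/-- The Hadamard–Fischer–Koteljanskii inequality, in block form. -/
theorem PosDef.det_toBlocks₁₁_mul_det_le {M : Matrix (l ⊕ (m ⊕ n)) (l ⊕ (m ⊕ n)) ℝ}
    (hM : M.PosDef) :
    M.toBlocks₁₁.det * M.det ≤
      (M.submatrix (Sum.map id Sum.inl) (Sum.map id Sum.inl)).det *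
        (M.submatrix (Sum.map id Sum.inr) (Sum.map id Sum.inr)).det := by
  rw [hM.det_submatrix_sumMap Sum.inl_injective, hM.det_submatrix_sumMap Sum.inr_injective,
    hM.det_eq_mul_det_schurComplement, mul_mul_mul_comm, ← mul_assoc]
  have hpos := hM.toBlocks₁₁.det_pos
  exact mul_le_mul_of_nonneg_left
    hM.schurComplement.det_le_det_toBlocks₁₁_mul_det_toBlocks₂₂ (mul_pos hpos hpos).le

end SchurComplement

/-- A principal minor may be computed along any injective enumeration of its index set. -/
theorem det_submatrix_eq_of_range_eq {R V m : Type*} [CommRing R] [DecidableEq V] [Fintype m]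
    [DecidableEq m] (K : Matrix V V R) {g : m → V} (hg : Function.Injective g) {S : Finset V}
    (hS : Set.range g = S) :
    (K.submatrix g g).det =
      (K.submatrix (Subtype.val : {x // x ∈ S} → V) Subtype.val).det :=
  det_submatrix_equiv_self ((Equiv.ofInjective g hg).trans (Equiv.setCongr hS))
    (K.submatrix (Subtype.val : {x // x ∈ S} → V) Subtype.val)

/-- The **Hadamard–Fischer–Koteljanskii inequality** for principal minors. -/
theorem PosDef.det_inter_mul_det_union_le {V : Type*} [DecidableEq V]
    {K : Matrix V V ℝ} (hK : K.PosDef) (S T : Finset V) :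
    (K.submatrix (Subtype.val : {x // x ∈ S ∩ T} → V) Subtype.val).det *
        (K.submatrix (Subtype.val : {x // x ∈ S ∪ T} → V) Subtype.val).det ≤
      (K.submatrix (Subtype.val : {x // x ∈ S} → V) Subtype.val).det *
        (K.submatrix (Subtype.val : {x // x ∈ T} → V) Subtype.val).det := by
  let g : {x // x ∈ S ∩ T} ⊕ ({x // x ∈ S \ T} ⊕ {x // x ∈ T \ S}) → V :=
    Sum.elim Subtype.val (Sum.elim Subtype.val Subtype.val)
  have hg : Function.Injective g := by
    rintro (⟨x, hx⟩ | ⟨x, hx⟩ | ⟨x, hx⟩) (⟨y, hy⟩ | ⟨y, hy⟩ | ⟨y, hy⟩) h <;>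
      simp only [g, Sum.elim_inl, Sum.elim_inr] at h <;> subst h <;>
      simp only [Finset.mem_inter, Finset.mem_sdiff] at hx hy <;> first | rfl | tauto
  have hunion : Set.range g = (S ∪ T : Finset V) := by
    ext x
    simp [g, Set.Sum.elim_range]
    tauto
  have hS : Set.range (g ∘ Sum.map id Sum.inl) = S := by
    ext x
    simp [g, Sum.elim_comp_map, Set.Sum.elim_range]
    tauto
  have hT : Set.range (g ∘ Sum.map id Sum.inr) = T := by
    ext x
    simp [g, Sum.elim_comp_map, Set.Sum.elim_range]
    tauto
  rw [← K.det_submatrix_eq_of_range_eq hg hunion,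
    ← K.det_submatrix_eq_of_range_eq
      (hg.comp (Function.injective_id.sumMap Sum.inl_injective)) hS,
    ← K.det_submatrix_eq_of_range_eq
      (hg.comp (Function.injective_id.sumMap Sum.inr_injective)) hT]
  exact (hK.submatrix hg).det_toBlocks₁₁_mul_det_le

end Matrix

/-- The log-determinant of principal submatrices of a positive definite matrix is a
submodular set function. -/
theorem logdet_submodular {V : Type*} [Fintype V] [DecidableEq V]
    (K : Matrix V V ℝ) (hK : K.PosDef)
    (f : Finset V → ℝ)
    (hf : ∀ S : Finset V,
      f S = Real.log (Matrix.det (K.submatrix (Subtype.val : {x // x ∈ S} → V) Subtype.val))) :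
    ∀ S T : Finset V, f (S ∩ T) + f (S ∪ T) ≤ f S + f T := by
  intro S T
  have hpos (U : Finset V) :
      0 < (K.submatrix (Subtype.val : {x // x ∈ U} → V) Subtype.val).det :=
    (hK.submatrix Subtype.val_injective).det_pos
  rw [hf, hf, hf, hf, ← Real.log_mul (hpos _).ne' (hpos _).ne',
    ← Real.log_mul (hpos _).ne' (hpos _).ne']
  exact Real.log_le_log (mul_pos (hpos _) (hpos _)) (hK.det_inter_mul_det_union_le S T)
end

section
/- The generalized hypervolume indicator is weakly Pareto complete: let ρ be a probability measure on Fin M → ℝ such that ρ-almost every λ has λ m > 0 for all m, and let A and B be finite nonempty subsets of Fin M → ℝ such that for every b ∈ B there exists a ∈ A with b ⪯ a. If the functions λ ↦ max_{a ∈ A} s_λ(a) and λ ↦ max_{b ∈ B} s_λ(b) are ρ-integrable, then ∫ (max_{b ∈ B} s_λ(b)) dρ(λ) ≤ ∫ (max_{a ∈ A} s_λ(a)) dρ(λ). -/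
noncomputable section

/-- The hypervolume scalarization `s_λ(a) = min_m (max(0, (a m − r m)/λ m))^M`
with reference point `r`. -/
def hvScal {M : ℕ} (hM : 1 ≤ M) (r lam a : Fin M → ℝ) : ℝ :=
  Finset.univ.inf' (Finset.univ_nonempty_iff.mpr (Fin.pos_iff_nonempty.mp hM))
    fun m => (max 0 ((a m - r m) / lam m)) ^ M

end

open MeasureTheory

/-- The hypervolume scalarization is monotone for weak Pareto dominance. -/
theorem hvScal_mono {M : ℕ} (hM : 1 ≤ M) (r : Fin M → ℝ) {lam a b : Fin M → ℝ}
    (hlam : ∀ m, 0 < lam m) (hab : ∀ m, b m ≤ a m) :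
    hvScal hM r lam b ≤ hvScal hM r lam a := by
  refine Finset.inf'_mono_fun fun m _ => ?_
  have := (hlam m).le
  have := hab m
  gcongr

/-- The generalized hypervolume indicator is weakly Pareto complete: if `A` weakly dominates
`B` then the expected maximal hypervolume scalarization of `B` under the weight distribution
`ρ` does not exceed that of `A`. -/
theorem generalizedHypervolume_le_of_dominates {M : ℕ} (hM : 1 ≤ M) (r : Fin M → ℝ)
    (ρ : Measure (Fin M → ℝ)) [IsProbabilityMeasure ρ]
    (hρ : ∀ᵐ lam ∂ρ, ∀ m, 0 < lam m)
    (A B : Finset (Fin M → ℝ)) (hA : A.Nonempty) (hB : B.Nonempty)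
    (hdom : ∀ b ∈ B, ∃ a ∈ A, ∀ m, b m ≤ a m)
    (hintA : Integrable (fun lam => A.sup' hA fun a => hvScal hM r lam a) ρ)
    (hintB : Integrable (fun lam => B.sup' hB fun b => hvScal hM r lam b) ρ) :
    ∫ lam, (B.sup' hB fun b => hvScal hM r lam b) ∂ρ
      ≤ ∫ lam, (A.sup' hA fun a => hvScal hM r lam a) ∂ρ := by
  refine integral_mono_ae hintB hintA ?_
  filter_upwards [hρ] with lam hlam
  refine Finset.sup'_le hB _ fun b hb => ?_
  obtain ⟨a, ha, hab⟩ := hdom b hb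
  exact (hvScal_mono hM r hlam hab).trans (Finset.le_sup' (hvScal hM r lam) ha)
end
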